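/- Let $H$ be a $(d+1)$-uniform hypergraph possessing at least one spanning hypertree. Then the normalized volume of the hypergraphic zonotope $\mathcal{Z}_H$ (with respect to the lattice $Z_{d-1}(H;\mathbb{Z})$ inside $Z_{d-1}(H;\mathbb{R})$) equals $\sum_T |\tilde H_{d-1}(T;\mathbb{Z})|$, summed over all spanning hypertrees $T$ of $H$. -/

import Mathlib

open Finset

variable {V : Type} [Fintype V] [LinearOrder V]

/-- Incidence number between a simplex `σ` and a codimension-one face `τ`:
`(-1)^i` where `i` is the position of the vertex `σ \ τ` in the increasing
ordering of `σ`, and `0` if `τ` is not a codimension-one face of `σ`. -/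
def inc (σ τ : Finset V) : ℤ :=
  if τ ⊆ σ ∧ σ.card = τ.card + 1 then
    ∑ v ∈ σ \ τ, (-1 : ℤ) ^ ((σ.filter (fun x => x < v)).card)
  else 0

/-- The augmented chain group of the simplicial complex `S` in (augmented) degree `k`:
the free module on the simplices of `S` having `k` vertices (so `k = 0` corresponds to
the empty simplex, and geometric dimension `k - 1`).  A basis simplex corresponds to the
oriented simplex `(v_0 v_1 ⋯)` with vertices listed in increasing order. -/
abbrev Chain (R : Type) [CommRing R] (S : Finset (Finset V)) (k : ℕ) : Type :=
  {σ : Finset V // σ ∈ S ∧ σ.card = k} → R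

/-- The simplicial boundary map (augmented: in lowest degree it is the augmentation
sending every vertex to `1`).  `bdry R S k : C_k → C_{k-1}` in the usual (geometric)
indexing of the paper. -/
def bdry (R : Type) [CommRing R] (S : Finset (Finset V)) (k : ℕ) :
    Chain R S (k + 1) →ₗ[R] Chain R S k :=
  LinearMap.pi fun τ => ∑ σ : {σ : Finset V // σ ∈ S ∧ σ.card = k + 1},
    (inc σ.1 τ.1 : R) • LinearMap.proj σ

/-- `S` is (the set of simplices of) a simplicial complex with vertex set `V`,
augmented with the empty simplex. -/
def IsComplex (S : Finset (Finset V)) : Prop :=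
  ∅ ∈ S ∧ (∀ σ ∈ S, ∀ τ ⊆ σ, τ ∈ S) ∧ ∀ v : V, {v} ∈ S

/-- The simplicial complex associated to a `(d+1)`-uniform hypergraph with edge set `E`:
the full `(d-1)`-skeleton on the vertex set together with the edges. -/
def cx (E : Finset (Finset V)) (d : ℕ) : Finset (Finset V) :=
  univ.filter (fun σ : Finset V => σ.card ≤ d) ∪ E

/-- The complex of the complete `(d+1)`-uniform hypergraph on `n` vertices. -/
def completeCx (n d : ℕ) : Finset (Finset (Fin n)) :=
  univ.filter (fun σ : Finset (Fin n) => σ.card ≤ d + 1)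

/-- Coefficientwise inclusion of integral chains into real chains. -/
def castChain (S : Finset (Finset V)) (k : ℕ) : Chain ℤ S k →ₗ[ℤ] Chain ℝ S k :=
  LinearMap.pi fun τ => ((Int.castAddHom ℝ).toIntLinearMap).comp (LinearMap.proj τ)

open MeasureTheory

/-- The hypergraphic zonotope `𝒵_H ⊆ Z_{d-1}(H; ℝ) ⊆ C_{d-1}(H; ℝ)` of a
`(d+1)`-uniform hypergraph with edge set `E` (here `d = k + 1`): the Minkowski sum of
the segments `conv {0, ∂_d((v₀v₁⋯v_d))}` over the edges of `H`. -/
noncomputable def hZonotope (E : Finset (Finset V)) (k : ℕ) :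
    Set (Chain ℝ (cx E (k + 1)) (k + 1)) :=
  {x | ∃ c : {σ : Finset V // σ ∈ cx E (k + 1) ∧ σ.card = k + 2} → ℝ,
    (∀ σ, c σ ∈ Set.Icc (0 : ℝ) 1) ∧
    x = ∑ σ, c σ • bdry ℝ (cx E (k + 1)) (k + 1) (Pi.single σ 1)}

/-- The order of the group `H̃_{d-1}(F; ℤ) = Z_{d-1}(F; ℤ)/B_{d-1}(F; ℤ)` for the
`(d+1)`-uniform hypergraph with edge set `F`, where `d = k + 1`. -/
noncomputable def cardH (F : Finset (Finset V)) (k : ℕ) : ℕ :=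
  Nat.card
    (LinearMap.ker (bdry ℤ (cx F (k + 1)) k) ⧸
      Submodule.comap (LinearMap.ker (bdry ℤ (cx F (k + 1)) k)).subtype
        (LinearMap.range (bdry ℤ (cx F (k + 1)) (k + 1))))

/-- `F` is (the edge set of) a spanning hypertree of the `(d+1)`-uniform hypergraph,
where `d = k + 1`: `H̃_d(F; ℝ) = 0` and `H̃_{d-1}(F; ℝ) = 0`. -/
def IsHypertree (F : Finset (Finset V)) (k : ℕ) : Prop :=
  LinearMap.ker (bdry ℝ (cx F (k + 1)) (k + 1)) = ⊥ ∧
    LinearMap.ker (bdry ℝ (cx F (k + 1)) k) = LinearMap.range (bdry ℝ (cx F (k + 1)) (k + 1))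

/-- The zonotope generated by the vectors `v i`, `i ∈ s`: the Minkowski sum of the segments
`[0, v i]`. -/
def zono {ι M : Type*} [AddCommGroup M] [Module ℝ M] (v : ι → M) (s : Finset ι) : Set M :=
  (fun c : ι → ℝ => ∑ i ∈ s, c i • v i) '' Set.Icc 0 1

section zono

variable {ι M N : Type*} [AddCommGroup M] [Module ℝ M] [AddCommGroup N] [Module ℝ N]

theorem image_zono (A : M →ₗ[ℝ] N) (v : ι → M) (s : Finset ι) :
    A '' zono v s = zono (fun i => A (v i)) s := by
  simp [zono, Set.image_image]

theorem zono_nonempty (v : ι → M) (s : Finset ι) : (zono v s).Nonempty :=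
  ⟨_, 0, by simp, rfl⟩

theorem convex_zono (v : ι → M) (s : Finset ι) : Convex ℝ (zono v s) := by
  let f : (ι → ℝ) →ₗ[ℝ] M :=
    ∑ i ∈ s, (LinearMap.proj i : (ι → ℝ) →ₗ[ℝ] ℝ).smulRight (v i)
  have h : zono v s = f '' Set.Icc 0 1 := by simp [zono, f]
  rw [h]
  exact (convex_Icc (𝕜 := ℝ) (0 : ι → ℝ) 1).linear_image f

theorem isCompact_zono [TopologicalSpace M] [ContinuousAdd M] [ContinuousSMul ℝ M]
    (v : ι → M) (s : Finset ι) : IsCompact (zono v s) := by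
  have h : IsCompact (Set.Icc (0 : ι → ℝ) 1) := by
    rw [← Set.pi_univ_Icc]
    exact isCompact_univ_pi fun _ => isCompact_Icc
  exact h.image (by fun_prop)

theorem zono_subset_span (v : ι → M) (s : Finset ι) :
    zono v s ⊆ Submodule.span ℝ (v '' s) := by
  rintro _ ⟨c, -, rfl⟩
  exact Submodule.sum_mem _ fun i hi => Submodule.smul_mem _ _ (Submodule.subset_span ⟨i, hi, rfl⟩)

theorem mem_zono_insert [DecidableEq ι] {v : ι → M} {s : Finset ι} {a : ι} (ha : a ∉ s) {x : M} :
    x ∈ zono v (insert a s) ↔ ∃ t ∈ Set.Icc (0 : ℝ) 1, x - t • v a ∈ zono v s := by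
  constructor
  · rintro ⟨c, hc, rfl⟩
    exact ⟨c a, ⟨hc.1 a, hc.2 a⟩, c, hc, by simp [Finset.sum_insert ha]⟩
  · rintro ⟨t, ht, c, hc, h⟩
    refine ⟨Function.update c a t, ⟨fun i => ?_, fun i => ?_⟩, ?_⟩
    · by_cases hi : i = a
      · subst hi; simpa using ht.1
      · simpa [hi] using hc.1 i
    · by_cases hi : i = a
      · subst hi; simpa using ht.2
      · simpa [hi] using hc.2 i
    · have : ∑ i ∈ s, Function.update c a t i • v i = ∑ i ∈ s, c i • v i :=
        Finset.sum_congr rfl fun i hi => by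
          rw [Function.update_of_ne (ne_of_mem_of_not_mem hi ha)]
      simp only [Finset.sum_insert ha, this, Function.update_self]
      simp only at h
      rw [h]; abel

/-- Sweeping a compact convex subset of the line along a unit segment adds one to its length. -/
theorem volume_sweep_real {K : Set ℝ} (hK : IsCompact K) (hc : Convex ℝ K) (hne : K.Nonempty) :
    volume {x : ℝ | ∃ t ∈ Set.Icc (0 : ℝ) 1, x - t ∈ K} = volume K + 1 := by
  have hK' := eq_Icc_of_connected_compact (hc.isConnected hne) hK
  have hle : sInf K ≤ sSup K := by
    by_contra h
    rw [hK', Set.Icc_eq_empty h] at hne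
    simp at hne
  have : {x : ℝ | ∃ t ∈ Set.Icc (0 : ℝ) 1, x - t ∈ K} = Set.Icc (sInf K) (sSup K + 1) := by
    ext x
    rw [hK']
    simp only [csInf_Icc hle, csSup_Icc hle, Set.mem_ofPred_eq, Set.mem_Icc]
    constructor
    · rintro ⟨t, ⟨h0, h1⟩, h2, h3⟩
      constructor <;> linarith
    · rintro ⟨h1, h2⟩
      rcases le_total x (sSup K) with h | h
      · exact ⟨0, by simp, by simpa using h1, by simpa using h⟩
      · exact ⟨x - sSup K, ⟨by linarith, by linarith⟩, by linarith, by linarith⟩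
  rw [this, hK', Real.volume_Icc, csInf_Icc hle, csSup_Icc hle, Real.volume_Icc,
    ← ENNReal.ofReal_one, ← ENNReal.ofReal_add (by linarith) (by norm_num)]
  congr 1; ring

/-- Sweeping a compact convex set along a unit segment adds the volume of its projection. -/
theorem volume_sweep {n : ℕ} {K : Set (ℝ × (Fin n → ℝ))} (hK : IsCompact K) (hc : Convex ℝ K) :
    volume {x : ℝ × (Fin n → ℝ) | ∃ t ∈ Set.Icc (0 : ℝ) 1, (x.1 - t, x.2) ∈ K} =
      volume K + volume (Prod.snd '' K) := by
  set L := {x : ℝ × (Fin n → ℝ) | ∃ t ∈ Set.Icc (0 : ℝ) 1, (x.1 - t, x.2) ∈ K} with hL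
  have hLc : IsCompact L := by
    have : L = (fun p : ℝ × ℝ × (Fin n → ℝ) => (p.1 + p.2.1, p.2.2)) '' (Set.Icc 0 1 ×ˢ K) := by
      ext ⟨x, y⟩
      simp only [hL, Set.mem_ofPred_eq, Set.mem_image, Set.mem_prod, Prod.exists, Prod.mk.injEq]
      constructor
      · rintro ⟨t, ht, h⟩
        exact ⟨t, x - t, y, ⟨ht, h⟩, by ring, rfl⟩
      · rintro ⟨t, x', y', ⟨ht, h⟩, rfl, rfl⟩
        exact ⟨t, ht, by simpa using h⟩
    rw [this]
    exact (isCompact_Icc.prod hK).image (by fun_prop)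
  have hP : MeasurableSet (Prod.snd '' K) := (hK.image continuous_snd).measurableSet
  rw [Measure.volume_eq_prod, Measure.prod_apply_symm hLc.measurableSet,
    Measure.prod_apply_symm hK.measurableSet, ← lintegral_indicator_one hP,
    ← lintegral_add_right _ (measurable_one.indicator hP)]
  refine lintegral_congr fun y => ?_
  by_cases hy : y ∈ Prod.snd '' K
  · rw [Set.indicator_of_mem hy]
    have hKy : IsCompact ((fun x : ℝ => (x, y)) ⁻¹' K) := by
      have : Topology.IsClosedEmbedding (fun x : ℝ => (x, y)) := by
        refine Topology.IsClosedEmbedding.of_continuous_injective_isClosedMap (by fun_prop)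
          (fun a b h => by simpa using h) ?_
        exact isClosedMap_prodMk_right y
      exact this.isCompact_preimage hK
    have hcy : Convex ℝ ((fun x : ℝ => (x, y)) ⁻¹' K) := by
      intro a ha b hb s t hs ht hst
      have := hc ha hb hs ht hst
      simpa [← add_smul, hst] using this
    refine volume_sweep_real hKy hcy ?_
    obtain ⟨⟨x, y'⟩, h, rfl⟩ := hy
    exact ⟨x, h⟩
  · rw [Set.indicator_of_notMem hy]
    have h1 : (fun x : ℝ => (x, y)) ⁻¹' K = ∅ := by
      ext x; simp only [Set.mem_preimage, Set.mem_empty_iff_false, iff_false]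
      exact fun h => hy ⟨_, h, rfl⟩
    have h2 : (fun x : ℝ => (x, y)) ⁻¹' L = ∅ := by
      ext x; simp only [Set.mem_preimage, Set.mem_empty_iff_false, iff_false]
      rintro ⟨t, -, h⟩
      exact hy ⟨_, h, rfl⟩
    simp [h1, h2]

theorem volume_zono_eq_zero {n : ℕ} (v : ι → Fin n → ℝ) {s : Finset ι} (hs : s.card < n) :
    volume (zono v s) = 0 := by
  refine measure_mono_null (zono_subset_span v s) (Measure.addHaar_submodule _ _ fun h => ?_)
  classical
  have h1 := finrank_span_finset_le_card (R := ℝ) (s.image v)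
  rw [Finset.coe_image, Set.finrank, h, finrank_top, Module.finrank_fin_fun] at h1
  exact absurd (h1.trans Finset.card_image_le) (by omega)

/-- Adding a generator `v a` along the first coordinate axis. -/
theorem volume_zono_insert_single [DecidableEq ι] {n : ℕ} (v : ι → Fin (n + 1) → ℝ) {s : Finset ι}
    {a : ι} (ha : a ∉ s) (hva : v a = Pi.single 0 1) :
    volume (zono v (insert a s)) =
      volume (zono v s) + volume (zono (fun i => Fin.tail (v i)) s) := by
  let e := MeasurableEquiv.piFinSuccAbove (fun _ : Fin (n + 1) => ℝ) 0
  have he : MeasurePreserving e.symm :=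
    (volume_preserving_piFinSuccAbove (fun _ : Fin (n + 1) => ℝ) 0).symm _
  have hsymm : ∀ p : ℝ × (Fin n → ℝ), e.symm p = Fin.cons p.1 p.2 := by
    intro p
    simp [e, MeasurableEquiv.piFinSuccAbove_symm_apply]
    rfl
  have hvol : ∀ A, volume (e.symm ⁻¹' A) = volume A := fun A => he.measure_preimage_equiv A
  let K := e.symm ⁻¹' zono v s
  have hKe : K = (fun x : Fin (n + 1) → ℝ => (x 0, Fin.tail x)) '' zono v s := by
    ext ⟨x, y⟩
    simp only [K, Set.mem_preimage, hsymm, Set.mem_image, Prod.mk.injEq]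
    constructor
    · exact fun h => ⟨_, h, by simp, by simp⟩
    · rintro ⟨z, h, rfl, rfl⟩
      simpa using h
  have hK : IsCompact K := by
    rw [hKe]
    refine (isCompact_zono v s).image ?_
    unfold Fin.tail
    fun_prop
  have hc : Convex ℝ K := by
    intro a ha b hb p q hp hq hpq
    have := convex_zono v s ha hb hp hq hpq
    simp only [K, Set.mem_preimage]
    convert this using 1
    simp only [hsymm]
    ext i
    refine Fin.cases ?_ (fun j => ?_) i <;> simp
  have h := volume_sweep hK hc
  rw [hvol] at h
  have hP : Prod.snd '' K = zono (fun i => Fin.tail (v i)) s := by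
    rw [hKe, Set.image_image]
    exact image_zono (LinearMap.funLeft ℝ ℝ Fin.succ) v s
  rw [← hP, ← h, ← hvol]
  congr 1
  ext ⟨x, y⟩
  simp only [K, Set.mem_preimage, hsymm, mem_zono_insert ha, Set.mem_ofPred_eq]
  have hsub : ∀ t : ℝ, (Fin.cons x y : Fin (n + 1) → ℝ) - t • v a = Fin.cons (x - t) y := by
    intro t
    rw [hva]
    ext i
    refine Fin.cases ?_ (fun j => ?_) i <;> simp
  simp only [hsub]

theorem volume_zono_linearMap {n : ℕ} (A : (Fin n → ℝ) →ₗ[ℝ] (Fin n → ℝ)) (v : ι → Fin n → ℝ)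
    (s : Finset ι) : volume (zono (fun i => A (v i)) s) =
      ENNReal.ofReal |LinearMap.det A| * volume (zono v s) := by
  rw [← image_zono, Measure.addHaar_image_linearMap]

/-- The volume of a zonotope is the sum of the volumes of its generating parallelepipeds. -/
theorem volume_zono {n : ℕ} (v : ι → Fin n → ℝ) (s : Finset ι) :
    volume (zono v s) = ∑ t ∈ s.powersetCard n, volume (zono v t) := by
  classical
  induction s using Finset.induction_on generalizing n with
  | empty =>
    rcases n with _ | n
    · simp
    · rw [volume_zono_eq_zero v (by simp), Finset.powersetCard_eq_empty.2 (by simp),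
        Finset.sum_empty]
  | insert a s ha ih =>
    rcases n with _ | n
    · simp only [Finset.powersetCard_zero, Finset.sum_singleton]
      congr 1
      rw [Subsingleton.eq_univ_of_nonempty (zono_nonempty _ _),
        Subsingleton.eq_univ_of_nonempty (zono_nonempty _ _)]
    have key : ∀ w : ι → Fin (n + 1) → ℝ, w a = Pi.single 0 1 →
        volume (zono w (insert a s)) =
          ∑ t ∈ (insert a s).powersetCard (n + 1), volume (zono w t) := by
      intro w hw
      have hdisj : Disjoint (s.powersetCard (n + 1)) ((s.powersetCard n).image (insert a)) := by
        rw [Finset.disjoint_left]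
        intro t ht ht'
        obtain ⟨u, -, rfl⟩ := Finset.mem_image.1 ht'
        exact ha ((Finset.mem_powersetCard.1 ht).1 (Finset.mem_insert_self _ _))
      have hinj : Set.InjOn (insert a) (s.powersetCard n : Set (Finset ι)) := by
        intro t ht u hu htu
        have ht := fun h => ha ((Finset.mem_powersetCard.1 (Finset.mem_coe.1 ht)).1 h)
        have hu := fun h => ha ((Finset.mem_powersetCard.1 (Finset.mem_coe.1 hu)).1 h)
        rw [← Finset.erase_insert ht, ← Finset.erase_insert hu, htu]
      rw [Finset.powersetCard_succ_insert ha, Finset.sum_union hdisj, Finset.sum_image hinj,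
        volume_zono_insert_single w ha hw, ih, ih]
      congr 1
      refine Finset.sum_congr rfl fun t ht => ?_
      obtain ⟨hts, htn⟩ := Finset.mem_powersetCard.1 ht
      rw [volume_zono_insert_single w (fun h => ha (hts h)) hw,
        volume_zono_eq_zero w (by omega), zero_add]
    by_cases hv : v a = 0
    · have h0 : ∀ t, a ∉ t → zono v (insert a t) = zono v t := by
        intro t hat
        simp [zono, Finset.sum_insert hat, hv]
      rw [h0 s ha, ih]
      refine Finset.sum_subset (Finset.powersetCard_mono (Finset.subset_insert _ _)) ?_
      intro t ht hts
      obtain ⟨ht1, ht2⟩ := Finset.mem_powersetCard.1 ht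
      have hat : a ∈ t := by
        by_contra h
        exact hts (Finset.mem_powersetCard.2
          ⟨(Finset.subset_insert_iff_of_notMem h).1 ht1, ht2⟩)
      rw [← Finset.insert_erase hat, h0 _ (Finset.notMem_erase _ _)]
      exact volume_zono_eq_zero v (by rw [Finset.card_erase_of_mem hat]; omega)
    · obtain ⟨A, hA⟩ := SeparatingDual.exists_continuousLinearEquiv_apply_eq (R := ℝ) hv
        (show (Pi.single 0 1 : Fin (n + 1) → ℝ) ≠ 0 by simp)
      have h := key (fun i => A (v i)) hA
      have hdet : LinearMap.det (A.toLinearEquiv : (Fin (n + 1) → ℝ) →ₗ[ℝ] _) ≠ 0 :=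
        (LinearEquiv.isUnit_det' A.toLinearEquiv).ne_zero
      have hvol : ∀ t, volume (zono (fun i => A (v i)) t) =
          ENNReal.ofReal |LinearMap.det (A.toLinearEquiv : (Fin (n + 1) → ℝ) →ₗ[ℝ] _)| *
            volume (zono v t) :=
        volume_zono_linearMap (A.toLinearEquiv : (Fin (n + 1) → ℝ) →ₗ[ℝ] (Fin (n + 1) → ℝ)) v
      simp only [hvol, ← Finset.mul_sum] at h
      exact (ENNReal.mul_right_inj (by simpa using hdet) ENNReal.ofReal_ne_top).1 h

end zono
section lattice

theorem card_quotient_range_toLin' {m : ℕ} {M : Matrix (Fin m) (Fin m) ℤ} (hM : M.det ≠ 0) :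
    Nat.card ((Fin m → ℤ) ⧸ LinearMap.range (Matrix.toLin' M)) = M.det.natAbs := by
  have hinj : Function.Injective (Matrix.toLin' M) := by
    rw [← LinearMap.ker_eq_bot]
    exact LinearMap.ker_eq_bot'.2 fun x hx => Matrix.eq_zero_of_mulVec_eq_zero hM hx
  rw [← Submodule.natAbs_det_equiv _ (LinearEquiv.ofInjective _ hinj), ← LinearMap.det_toLin' M]
  rfl

/-- A zonotope is the image of the unit cube indexed by any enumeration of its generators. -/
theorem zono_eq_image_linearCombination {ι κ M : Type*} [AddCommGroup M] [Module ℝ M]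
    [Fintype κ] (v : ι → M) (s : Finset ι) (e : κ ≃ s) :
    zono v s = Fintype.linearCombination ℝ (fun i => v (e i)) '' Set.Icc 0 1 := by
  classical
  ext x
  constructor
  · rintro ⟨c, hc, rfl⟩
    refine ⟨fun i => c (e i), ⟨fun i => hc.1 _, fun i => hc.2 _⟩, ?_⟩
    rw [Fintype.linearCombination_apply, Equiv.sum_comp e (fun i : s => c i • v i),
      Finset.sum_coe_sort s (fun i => c i • v i)]
  · rintro ⟨c, hc, rfl⟩
    refine ⟨fun i => if h : i ∈ s then c (e.symm ⟨i, h⟩) else 0, ⟨fun i => ?_, fun i => ?_⟩, ?_⟩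
    · by_cases h : i ∈ s
      · simpa [h] using hc.1 _
      · simp [h]
    · by_cases h : i ∈ s
      · simpa [h] using hc.2 _
      · simp [h]
    · simp only
      rw [Fintype.linearCombination_apply, ← Finset.sum_coe_sort, ← Equiv.sum_comp e]
      exact Finset.sum_congr rfl fun i _ => by simp

variable {ι κ : Type*} [Fintype κ] {m : ℕ} (w : ι → Fin m → ℤ) (s : Finset ι) (e : κ ≃ s)

theorem volume_zono_of_bijective
    (h : Function.Bijective (Fintype.linearCombination ℝ fun i => ((↑) : ℤ → ℝ) ∘ w (e i))) :
    volume (zono (fun i => ((↑) : ℤ → ℝ) ∘ w i) s) =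
      Nat.card ((Fin m → ℤ) ⧸
        LinearMap.range (Fintype.linearCombination ℤ fun i => w (e i))) := by
  have hcard : Fintype.card κ = m := by
    have := (LinearEquiv.ofBijective _ h).finrank_eq
    simpa using this
  let f : Fin m ≃ κ := (Fintype.equivFinOfCardEq hcard).symm
  let M : Matrix (Fin m) (Fin m) ℤ := Matrix.of fun i j => w (e (f j)) i
  have hR : ∀ c, Fintype.linearCombination ℝ (fun i => ((↑) : ℤ → ℝ) ∘ w (e (f i))) c =
      Matrix.toLin' (M.map ((↑) : ℤ → ℝ)) c := by
    intro c
    ext i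
    simp [Fintype.linearCombination_apply, M, Matrix.mulVec, dotProduct, mul_comm]
  have hRf : ∀ c, Fintype.linearCombination ℝ (fun i => ((↑) : ℤ → ℝ) ∘ w (e (f i))) c =
      Fintype.linearCombination ℝ (fun i => ((↑) : ℤ → ℝ) ∘ w (e i)) (c ∘ f.symm) := by
    intro c
    rw [Fintype.linearCombination_apply, Fintype.linearCombination_apply, ← Equiv.sum_comp f]
    simp
  have hZ : LinearMap.range (Fintype.linearCombination ℤ fun i => w (e i)) =
      LinearMap.range (Matrix.toLin' M) := by
    rw [Fintype.range_linearCombination, Matrix.range_toLin']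
    congr 1
    have := f.surjective.range_comp (fun i => w (e i))
    rw [← this]
    rfl
  have hdet : M.det ≠ 0 := by
    intro h0
    have h1 : (M.map ((↑) : ℤ → ℝ)).det = 0 := by
      have := Int.cast_det (R := ℝ) M
      rw [← this, h0, Int.cast_zero]
    obtain ⟨c, hc, hc0⟩ := Matrix.exists_mulVec_eq_zero_iff.2 h1
    have h2 := hR c
    rw [Matrix.toLin'_apply, hc0, hRf,
      ← map_zero (Fintype.linearCombination ℝ fun i => ((↑) : ℤ → ℝ) ∘ w (e i))] at h2
    refine hc (funext fun i => ?_)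
    simpa using congrFun (h.1 h2) (f i)
  rw [hZ, card_quotient_range_toLin' hdet, zono_eq_image_linearCombination _ s (f.trans e)]
  have : ⇑(Fintype.linearCombination ℝ (fun i => ((↑) : ℤ → ℝ) ∘ w ((f.trans e) i))) =
      Matrix.toLin' (M.map ((↑) : ℤ → ℝ)) := funext hR
  rw [this, Measure.addHaar_image_linearMap, LinearMap.det_toLin', ← Int.cast_det,
    ← Set.pi_univ_Icc, volume_pi_pi]
  simp only [Pi.zero_apply, Pi.one_apply, Real.volume_Icc, sub_zero, ENNReal.ofReal_one,
    Finset.prod_const_one, mul_one]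
  rw [← Int.cast_abs, Int.abs_eq_natAbs, Int.cast_natCast, ENNReal.ofReal_natCast]

theorem volume_zono_of_not_surjective
    (h : ¬ Function.Surjective (Fintype.linearCombination ℝ fun i => ((↑) : ℤ → ℝ) ∘ w (e i))) :
    volume (zono (fun i => ((↑) : ℤ → ℝ) ∘ w i) s) = 0 := by
  rw [zono_eq_image_linearCombination _ s e]
  refine measure_mono_null (t := LinearMap.range
    (Fintype.linearCombination ℝ fun i => ((↑) : ℤ → ℝ) ∘ w (e i))) ?_
    (Measure.addHaar_submodule _ _ fun h' => h (LinearMap.range_eq_top.1 h'))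
  exact Set.image_subset_range _ _

end lattice
section cycles

set_option linter.unusedSectionVars false

theorem inc_insert {v : V} {τ : Finset V} (hv : v ∉ τ) :
    inc (insert v τ) τ = (-1) ^ (τ.filter (fun x => x < v)).card := by
  have h : insert v τ \ τ = {v} := by
    rw [Finset.insert_sdiff_of_notMem _ hv, Finset.sdiff_self, insert_empty_eq]
  rw [inc, if_pos ⟨Finset.subset_insert _ _, Finset.card_insert_of_notMem hv⟩, h,
    Finset.sum_singleton, Finset.filter_insert, if_neg (lt_irrefl v)]

theorem inc_mul_inc_eq_zero {σ τ ρ : Finset V} (h : ¬ (ρ ⊆ τ ∧ τ ⊆ σ)) :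
    inc σ τ * inc τ ρ = 0 := by
  rw [not_and_or] at h
  rcases h with h | h
  · rw [inc.eq_1 τ ρ, if_neg (fun h' => h h'.1), mul_zero]
  · rw [inc.eq_1 σ τ, if_neg (fun h' => h h'.1), zero_mul]

/-- The boundary of a boundary vanishes. -/
theorem sum_inc_mul_inc (k : ℕ) {σ ρ : Finset V} (hσ : σ.card = k + 2) (hρ : ρ.card = k) :
    ∑ τ ∈ univ.filter (fun τ : Finset V => τ.card = k + 1), inc τ ρ * inc σ τ = 0 := by
  by_cases hsub : ρ ⊆ σ
  swap
  · exact Finset.sum_eq_zero fun τ _ => by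
      rw [mul_comm]; exact inc_mul_inc_eq_zero fun h => hsub (h.1.trans h.2)
  have hcard : (σ \ ρ).card = 2 := by rw [Finset.card_sdiff_of_subset hsub]; omega
  obtain ⟨u, v, huv, hdiff⟩ : ∃ u v, u < v ∧ σ \ ρ = {u, v} := by
    obtain ⟨u, v, huv, h⟩ := Finset.card_eq_two.1 hcard
    rcases lt_or_gt_of_ne huv with h' | h'
    · exact ⟨u, v, h', h⟩
    · exact ⟨v, u, h', by rw [h, Finset.pair_comm]⟩
  have hu : u ∉ ρ := (Finset.mem_sdiff.1 (hdiff ▸ Finset.mem_insert_self u {v})).2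
  have hv : v ∉ ρ := (Finset.mem_sdiff.1 (hdiff ▸ by simp : v ∈ σ \ ρ)).2
  have hσuv : σ = insert v (insert u ρ) := by
    rw [← Finset.sdiff_union_of_subset hsub, hdiff]
    ext x; simp; tauto
  have hσvu : σ = insert u (insert v ρ) := by
    rw [hσuv, Finset.insert_comm]
  have hvu : v ∉ insert u ρ := by simp [hv, huv.ne']
  have huv' : u ∉ insert v ρ := by simp [hu, huv.ne]
  have hne : insert u ρ ≠ insert v ρ := fun h => hvu (h ▸ Finset.mem_insert_self _ _)
  rw [Finset.sum_eq_add (insert u ρ) (insert v ρ) hne]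
  · rw [inc_insert hu, inc_insert hv, hσuv, inc_insert hvu, ← hσuv, hσvu, inc_insert huv',
      Finset.filter_insert, if_pos huv, Finset.filter_insert, if_neg huv.not_gt,
      Finset.card_insert_of_notMem (by simp [hu]), pow_succ]
    ring
  · intro τ hτ hττ
    rw [mul_comm]
    refine inc_mul_inc_eq_zero fun ⟨h1, h2⟩ => ?_
    have hc : (τ \ ρ).card = 1 := by
      rw [Finset.card_sdiff_of_subset h1, (Finset.mem_filter.1 hτ).2]; omega
    obtain ⟨x, hx⟩ := Finset.card_eq_one.1 hc
    have hτx : τ = insert x ρ := by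
      rw [← Finset.sdiff_union_of_subset h1, hx, Finset.singleton_union]
    have hxm : x ∈ σ \ ρ := Finset.sdiff_subset_sdiff h2 subset_rfl (hx ▸ by simp)
    rw [hdiff, Finset.mem_insert, Finset.mem_singleton] at hxm
    rcases hxm with rfl | rfl
    · exact hττ.1 hτx
    · exact hττ.2 hτx
  · intro h
    exact absurd (by simp [Finset.card_insert_of_notMem hu, hρ]) h
  · intro h
    exact absurd (by simp [Finset.card_insert_of_notMem hv, hρ]) h

/-- The function `f` on finite sets restricts to a cycle on the sets of cardinality `k + 1`. -/
def IsCyc (R : Type) [CommRing R] (k : ℕ) (f : Finset V → R) : Prop :=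
  ∀ ρ : Finset V, ρ.card = k →
    ∑ τ ∈ univ.filter (fun τ : Finset V => τ.card = k + 1), (inc τ ρ : R) * f τ = 0

theorem mem_cx_of_card_le {F : Finset (Finset V)} {d : ℕ} {τ : Finset V} (h : τ.card ≤ d) :
    τ ∈ cx F d := by
  simp [cx, h]

theorem bdry_apply (R : Type) [CommRing R] (S : Finset (Finset V)) (k : ℕ) (c : Chain R S (k + 1))
    (τ : {σ : Finset V // σ ∈ S ∧ σ.card = k}) :
    bdry R S k c τ = ∑ σ : {σ : Finset V // σ ∈ S ∧ σ.card = k + 1}, (inc σ.1 τ.1 : R) * c σ := by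
  simp [bdry]

theorem bdry_restrict_eq_zero_iff (R : Type) [CommRing R] (F : Finset (Finset V)) (k : ℕ)
    (f : Finset V → R) :
    bdry R (cx F (k + 1)) k (fun τ => f τ.1) = 0 ↔ IsCyc R k f := by
  have h : ∀ ρ, ∑ τ ∈ univ.filter (fun τ : Finset V => τ.card = k + 1), (inc τ ρ : R) * f τ =
      ∑ σ : {σ : Finset V // σ ∈ cx F (k + 1) ∧ σ.card = k + 1}, (inc σ.1 ρ : R) * f σ.1 :=
    fun ρ => Finset.sum_subtype _ (fun τ => by
      simp only [Finset.mem_filter, Finset.mem_univ, true_and]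
      exact ⟨fun h => ⟨mem_cx_of_card_le h.le, h⟩, fun h => h.2⟩) _
  simp only [funext_iff, bdry_apply, IsCyc, h, Pi.zero_apply]
  exact ⟨fun H ρ hρ => H ⟨ρ, mem_cx_of_card_le (by omega), hρ⟩, fun H ρ => H ρ.1 ρ.2.2⟩

theorem exists_eq_restrict {R : Type} [CommRing R] {S : Finset (Finset V)} {k : ℕ}
    (z : Chain R S k) : ∃ f : Finset V → R, z = fun τ => f τ.1 :=
  ⟨Function.extend Subtype.val z 0, funext fun τ =>
    (Subtype.val_injective.extend_apply _ _ τ).symm⟩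

/-- The functions `B i` restrict to a basis of the module of cycles on the sets of cardinality
`k + 1`. -/
structure IsCycBasis (R : Type) [CommRing R] (k : ℕ) {m : ℕ} (B : Fin m → Finset V → R) : Prop where
  isCyc : ∀ i, IsCyc R k (B i)
  linearIndependent :
    LinearIndependent R fun i => fun τ : {τ : Finset V // τ.card = k + 1} => B i τ.1
  exists_coeff : ∀ f, IsCyc R k f →
    ∃ a : Fin m → R, ∀ τ : Finset V, τ.card = k + 1 → f τ = ∑ i, a i * B i τ

/-- The chain with given coordinates in the cycle basis `B`. -/
def ofCoord {R : Type} [CommRing R] {m : ℕ} (B : Fin m → Finset V → R) (S : Finset (Finset V))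
    (k : ℕ) : (Fin m → R) →ₗ[R] Chain R S k :=
  Fintype.linearCombination R fun i => fun τ => B i τ.1

theorem ofCoord_apply {R : Type} [CommRing R] {m : ℕ} (B : Fin m → Finset V → R)
    (S : Finset (Finset V)) (k : ℕ) (a : Fin m → R)
    (τ : {τ : Finset V // τ ∈ S ∧ τ.card = k}) :
    ofCoord B S k a τ = ∑ i, a i * B i τ.1 := by
  simp [ofCoord, Fintype.linearCombination_apply]

namespace IsCycBasis

variable {R : Type} [CommRing R] {k m : ℕ} {B : Fin m → Finset V → R}

theorem ofCoord_injective (hB : IsCycBasis R k B) (F : Finset (Finset V)) :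
    Function.Injective (ofCoord B (cx F (k + 1)) (k + 1)) := by
  rw [← LinearMap.ker_eq_bot, LinearMap.ker_eq_bot']
  intro a ha
  refine funext fun i => Fintype.linearIndependent_iff.1 hB.linearIndependent a ?_ i
  ext τ
  have := congrFun ha ⟨τ.1, mem_cx_of_card_le τ.2.le, τ.2⟩
  rw [ofCoord_apply] at this
  simpa using this

theorem range_ofCoord (hB : IsCycBasis R k B) (F : Finset (Finset V)) :
    LinearMap.range (ofCoord B (cx F (k + 1)) (k + 1)) =
      LinearMap.ker (bdry R (cx F (k + 1)) k) := by
  apply le_antisymm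
  · rw [ofCoord, Fintype.range_linearCombination, Submodule.span_le]
    rintro _ ⟨i, rfl⟩
    exact (bdry_restrict_eq_zero_iff R F k (B i)).2 (hB.isCyc i)
  · intro z hz
    obtain ⟨f, rfl⟩ := exists_eq_restrict z
    obtain ⟨a, ha⟩ := hB.exists_coeff f ((bdry_restrict_eq_zero_iff R F k f).1 hz)
    exact ⟨a, funext fun τ => by rw [ofCoord_apply, ha τ.1 τ.2.2]⟩

end IsCycBasis

/-- The simplices of top dimension of a hypergraph are its edges. -/
def topEquiv {F : Finset (Finset V)} {k : ℕ} (hF : ∀ e ∈ F, e.card = k + 2) :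
    {σ : Finset V // σ ∈ cx F (k + 1) ∧ σ.card = k + 1 + 1} ≃ F :=
  Equiv.subtypeEquivRight fun σ => by
    simp only [cx, Finset.mem_union, Finset.mem_filter, Finset.mem_univ, true_and]
    exact ⟨fun h => h.1.resolve_left (by omega), fun h => ⟨Or.inr h, hF σ h⟩⟩

/-- `w σ` is the coordinate vector of the boundary of `σ` in the cycle basis `B`. -/
def IsBdryCoord (R : Type) [CommRing R] (k : ℕ) {m : ℕ} (B : Fin m → Finset V → R)
    (w : Finset V → Fin m → R) : Prop :=
  ∀ σ : Finset V, σ.card = k + 2 → ∀ τ : Finset V, τ.card = k + 1 →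
    (inc σ τ : R) = ∑ i, w σ i * B i τ

/-- The boundary map in coordinates with respect to a cycle basis. -/
def coordBdry {R : Type} [CommRing R] {m : ℕ} (w : Finset V → Fin m → R)
    (F : Finset (Finset V)) (k : ℕ) : Chain R (cx F (k + 1)) (k + 1 + 1) →ₗ[R] (Fin m → R) :=
  Fintype.linearCombination R fun σ => w σ.1

variable {R : Type} [CommRing R] {k m : ℕ} {B : Fin m → Finset V → R} {w : Finset V → Fin m → R}

theorem IsBdryCoord.bdry_eq (hw : IsBdryCoord R k B w) (F : Finset (Finset V)) :
    bdry R (cx F (k + 1)) (k + 1) =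
      ofCoord B (cx F (k + 1)) (k + 1) ∘ₗ coordBdry w F k := by
  refine LinearMap.ext fun c => funext fun τ => ?_
  rw [bdry_apply, LinearMap.comp_apply, ofCoord_apply]
  simp only [coordBdry, Fintype.linearCombination_apply, Finset.sum_apply, Pi.smul_apply,
    smul_eq_mul, Finset.sum_mul]
  rw [Finset.sum_comm]
  refine Finset.sum_congr rfl fun σ _ => ?_
  rw [hw σ.1 σ.2.2 τ.1 τ.2.2, Finset.sum_mul]
  exact Finset.sum_congr rfl fun i _ => by ring

theorem IsCycBasis.ker_bdry_eq_bot_iff (hB : IsCycBasis R k B) (hw : IsBdryCoord R k B w)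
    (F : Finset (Finset V)) :
    LinearMap.ker (bdry R (cx F (k + 1)) (k + 1)) = ⊥ ↔
      Function.Injective (coordBdry w F k) := by
  rw [hw.bdry_eq, LinearMap.ker_comp_of_ker_eq_bot _
    (LinearMap.ker_eq_bot.2 (hB.ofCoord_injective F)), LinearMap.ker_eq_bot]

theorem IsCycBasis.ker_bdry_eq_range_iff (hB : IsCycBasis R k B) (hw : IsBdryCoord R k B w)
    (F : Finset (Finset V)) :
    LinearMap.ker (bdry R (cx F (k + 1)) k) = LinearMap.range (bdry R (cx F (k + 1)) (k + 1)) ↔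
      Function.Surjective (coordBdry w F k) := by
  rw [hw.bdry_eq, ← hB.range_ofCoord, LinearMap.range_comp, ← LinearMap.range_eq_top,
    LinearMap.range_eq_map, (Submodule.map_injective_of_injective (hB.ofCoord_injective F)).eq_iff,
    eq_comm]

theorem IsCycBasis.isHypertree_iff {B : Fin m → Finset V → ℝ} {w : Finset V → Fin m → ℝ}
    (hB : IsCycBasis ℝ k B) (hw : IsBdryCoord ℝ k B w) (F : Finset (Finset V)) :
    IsHypertree F k ↔ Function.Bijective (coordBdry w F k) :=
  and_congr (hB.ker_bdry_eq_bot_iff hw F) (hB.ker_bdry_eq_range_iff hw F)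

theorem IsCycBasis.cardH_eq {B : Fin m → Finset V → ℤ} {w : Finset V → Fin m → ℤ}
    (hB : IsCycBasis ℤ k B) (hw : IsBdryCoord ℤ k B w) (F : Finset (Finset V)) :
    cardH F k = Nat.card ((Fin m → ℤ) ⧸ LinearMap.range (coordBdry w F k)) := by
  let f : (Fin m → ℤ) ≃ₗ[ℤ] LinearMap.ker (bdry ℤ (cx F (k + 1)) k) :=
    (LinearEquiv.ofInjective _ (hB.ofCoord_injective F)).trans
      (LinearEquiv.ofEq _ _ (hB.range_ofCoord F))
  have hf : ∀ a, (f a).1 = ofCoord B (cx F (k + 1)) (k + 1) a := fun a => rfl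
  refine (Nat.card_congr (Submodule.Quotient.equiv _ _ f ?_).toEquiv).symm
  ext z
  simp only [Submodule.mem_map, Submodule.mem_comap, hw.bdry_eq, LinearMap.mem_range,
    LinearMap.comp_apply]
  constructor
  · rintro ⟨_, ⟨c, rfl⟩, rfl⟩
    exact ⟨c, rfl⟩
  · rintro ⟨c, hc⟩
    exact ⟨_, ⟨c, rfl⟩, Subtype.ext hc⟩

theorem IsCyc.intCast {f : Finset V → ℤ} (hf : IsCyc ℤ k f) :
    IsCyc R k fun τ => (f τ : R) := by
  intro ρ hρ
  have := congrArg (Int.cast : ℤ → R) (hf ρ hρ)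
  simpa using this

theorem isCyc_inc {σ : Finset V} (hσ : σ.card = k + 2) : IsCyc ℤ k (inc σ) := by
  intro ρ hρ
  simpa using sum_inc_mul_inc k hσ hρ

theorem IsCycBasis.exists_isBdryCoord {B : Fin m → Finset V → ℤ} (hB : IsCycBasis ℤ k B) :
    ∃ w, IsBdryCoord ℤ k B w := by
  have h : ∀ σ : Finset V, ∃ a : Fin m → ℤ, σ.card = k + 2 →
      ∀ τ : Finset V, τ.card = k + 1 → inc σ τ = ∑ i, a i * B i τ := by
    intro σ
    by_cases hσ : σ.card = k + 2
    · obtain ⟨a, ha⟩ := hB.exists_coeff _ (isCyc_inc hσ)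
      exact ⟨a, fun _ => ha⟩
    · exact ⟨0, fun h => absurd h hσ⟩
  choose w hw using h
  exact ⟨w, fun σ hσ τ hτ => by simpa using hw σ hσ τ hτ⟩

theorem IsBdryCoord.intCast {B : Fin m → Finset V → ℤ} {w : Finset V → Fin m → ℤ}
    (hw : IsBdryCoord ℤ k B w) :
    IsBdryCoord R k (fun i τ => (B i τ : R)) fun σ => ((↑) : ℤ → R) ∘ w σ := by
  intro σ hσ τ hτ
  have := congrArg (Int.cast : ℤ → R) (hw σ hσ τ hτ)
  simpa using this

/-- An integral cycle basis is a real cycle basis as soon as there is a spanning hypertree. -/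
theorem IsCycBasis.real {B : Fin m → Finset V → ℤ} (hB : IsCycBasis ℤ k B)
    {F : Finset (Finset V)} (hF : IsHypertree F k) :
    IsCycBasis ℝ k fun i τ => (B i τ : ℝ) where
  isCyc i := IsCyc.intCast (hB.isCyc i)
  linearIndependent := by
    have h := (linearIndependent_algebraMap_comp_iff (R := ℤ) (S := ℝ)).2 hB.linearIndependent
    exact h
  exists_coeff f hf := by
    obtain ⟨w, hw⟩ := hB.exists_isBdryCoord
    have hz := (bdry_restrict_eq_zero_iff ℝ F k f).2 hf
    rw [← LinearMap.mem_ker, hF.2, (hw.intCast (R := ℝ)).bdry_eq] at hz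
    obtain ⟨c, hc⟩ := hz
    refine ⟨coordBdry (fun σ => ((↑) : ℤ → ℝ) ∘ w σ) F k c, fun τ hτ => ?_⟩
    have := congrFun hc ⟨τ, mem_cx_of_card_le hτ.le, hτ⟩
    rw [LinearMap.comp_apply, ofCoord_apply] at this
    exact this.symm

theorem hZonotope_eq {B : Fin m → Finset V → ℝ} {w : Finset V → Fin m → ℝ}
    (hw : IsBdryCoord ℝ k B w) {E : Finset (Finset V)} (hE : ∀ e ∈ E, e.card = k + 2) :
    hZonotope E k = ofCoord B (cx E (k + 1)) (k + 1) '' zono w E := by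
  have hsum : ∀ c : Chain ℝ (cx E (k + 1)) (k + 1 + 1),
      bdry ℝ (cx E (k + 1)) (k + 1) c =
        ∑ σ, c σ • bdry ℝ (cx E (k + 1)) (k + 1) (Pi.single σ 1) := by
    intro c
    conv_lhs => rw [pi_eq_sum_univ' c, map_sum]
    refine Finset.sum_congr rfl fun σ _ => ?_
    rw [map_smul]
  have h : hZonotope E k = bdry ℝ (cx E (k + 1)) (k + 1) '' Set.Icc 0 1 := by
    ext x
    constructor
    · rintro ⟨c, hc, rfl⟩
      exact ⟨c, ⟨fun σ => (hc σ).1, fun σ => (hc σ).2⟩, hsum c⟩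
    · rintro ⟨c, hc, rfl⟩
      exact ⟨c, fun σ => ⟨hc.1 σ, hc.2 σ⟩, hsum c⟩
  rw [h, hw.bdry_eq, LinearMap.coe_comp, Set.image_comp,
    zono_eq_image_linearCombination w E (topEquiv hE)]
  rfl

end cycles

open scoped Classical in
/-- Let `H` be a `(d+1)`-uniform hypergraph (with `d = k + 1`, edge
set `E`) possessing at least one spanning hypertree.  Then the volume of the
hypergraphic zonotope `𝒵_H`, normalized with respect to the lattice
`Z_{d-1}(H; ℤ)` inside `Z_{d-1}(H; ℝ)`, equals `∑_T |H̃_{d-1}(T; ℤ)|`, summed over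
all spanning hypertrees `T ⊆ E(H)`: concretely, for any `ℤ`-basis `b` of the lattice
`Z_{d-1}(H; ℤ)`, the Lebesgue volume of the preimage of `𝒵_H` under the coordinate
map `(c_i) ↦ ∑ c_i • b i` equals this sum. -/
theorem hZonotope_volume_eq_sum_hypertrees (d k : ℕ) (hdk : d = k + 1)
    (E : Finset (Finset V)) (hE : ∀ e ∈ E, e.card = d + 1)
    (hex : ∃ F ∈ E.powerset, IsHypertree F k)
    (m : ℕ) (b : Fin m → Chain ℤ (cx E (k + 1)) (k + 1))
    (hb₁ : ∀ i, bdry ℤ (cx E (k + 1)) k (b i) = 0)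
    (hb₂ : LinearIndependent ℤ b)
    (hb₃ : ∀ z : Chain ℤ (cx E (k + 1)) (k + 1),
      bdry ℤ (cx E (k + 1)) k z = 0 → z ∈ Submodule.span ℤ (Set.range b)) :
    (volume ((fun c : Fin m → ℝ =>
        ∑ i, c i • castChain (cx E (k + 1)) (k + 1) (b i)) ⁻¹' hZonotope E k)).toReal
      = ∑ F ∈ E.powerset, if IsHypertree F k then (cardH F k : ℝ) else 0 := by
  subst hdk
  obtain ⟨F₀, -, hF₀⟩ := hex
  choose B hBb using fun i => exists_eq_restrict (b i)
  have hB : IsCycBasis ℤ k B := by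
    refine ⟨fun i => ?_, ?_, fun f hf => ?_⟩
    · have h := hb₁ i
      rw [hBb] at h
      exact (bdry_restrict_eq_zero_iff ℤ E k (B i)).1 h
    · rw [Fintype.linearIndependent_iff] at hb₂ ⊢
      refine fun a ha => hb₂ a (funext fun τ => ?_)
      have h := congrFun ha ⟨τ.1, τ.2.2⟩
      simp only [hBb]
      simpa using h
    · have h := hb₃ _ ((bdry_restrict_eq_zero_iff ℤ E k f).2 hf)
      obtain ⟨a, ha⟩ := (Submodule.mem_span_range_iff_exists_fun ℤ).1 h
      refine ⟨a, fun τ hτ => ?_⟩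
      have h' := congrFun ha ⟨τ, mem_cx_of_card_le hτ.le, hτ⟩
      simp only [hBb] at h'
      simpa using h'.symm
  have hBR := hB.real hF₀
  obtain ⟨w, hw⟩ := hB.exists_isBdryCoord
  have hwR := hw.intCast (R := ℝ)
  have hmap : (fun c : Fin m → ℝ => ∑ i, c i • castChain (cx E (k + 1)) (k + 1) (b i)) =
      ofCoord (fun i τ => (B i τ : ℝ)) (cx E (k + 1)) (k + 1) := by
    funext c τ
    rw [ofCoord_apply]
    simp [hBb, castChain]
  rw [hmap, hZonotope_eq hwR hE, Set.preimage_image_eq _ (hBR.ofCoord_injective E), volume_zono]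
  have hterm : ∀ F ∈ E.powerset, F.card = m →
      volume (zono (fun σ => ((↑) : ℤ → ℝ) ∘ w σ) F) =
        if IsHypertree F k then (cardH F k : ENNReal) else 0 := by
    intro F hF hFm
    have hFk : ∀ e ∈ F, e.card = k + 2 := fun e he => hE e (Finset.mem_powerset.1 hF he)
    let e := topEquiv hFk
    have hcard : Fintype.card {σ : Finset V // σ ∈ cx F (k + 1) ∧ σ.card = k + 1 + 1} = m := by
      rw [Fintype.card_congr e, Fintype.card_coe, hFm]
    split_ifs with hT
    · rw [hB.cardH_eq hw]
      exact volume_zono_of_bijective w F e ((hBR.isHypertree_iff hwR F).1 hT)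
    · refine volume_zono_of_not_surjective w F e fun hs => hT ((hBR.isHypertree_iff hwR F).2 ?_)
      refine ⟨?_, hs⟩
      exact (LinearMap.injective_iff_surjective_of_finrank_eq_finrank (by simp [hcard])).2 hs
  have hcardT : ∀ F ∈ E.powerset, IsHypertree F k → F.card = m := by
    intro F hF hT
    have hFk : ∀ e ∈ F, e.card = k + 2 := fun e he => hE e (Finset.mem_powerset.1 hF he)
    have h := (LinearEquiv.ofBijective _ ((hBR.isHypertree_iff hwR F).1 hT)).finrank_eq
    rw [Module.finrank_fintype_fun_eq_card, Module.finrank_fin_fun,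
      Fintype.card_congr (topEquiv hFk), Fintype.card_coe] at h
    exact h
  have hsub : E.powersetCard m ⊆ E.powerset := fun F hF =>
    Finset.mem_powerset.2 (Finset.mem_powersetCard.1 hF).1
  rw [Finset.sum_congr rfl fun F hF => hterm F (hsub hF) (Finset.mem_powersetCard.1 hF).2,
    Finset.sum_subset hsub fun F hF hFm => if_neg fun hT =>
      hFm (Finset.mem_powersetCard.2 ⟨Finset.mem_powerset.1 hF, hcardT F hF hT⟩),
    ENNReal.toReal_sum fun F _ => by split_ifs <;> simp]
  exact Finset.sum_congr rfl fun F _ => by split_ifs <;> simp
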